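/- arXiv:2102.06898 — 7 statements merged into one kernel-verified Lean document; each statement's English description precedes it below -/
import Mathlib

section
/- There exist a real vector space V, a nonempty convex set M ⊆ V, and a preorder ≽ on M satisfying SI, such that when M is endowed with the coarsest topology making every mixture-preserving function M → ℝ continuous, the following hold: for every x ∈ M, the sets {y ∈ M : y ≽ x} and {y ∈ M : x ≽ y} are closed in M, but the graph {(x,y) ∈ M × M : x ≽ y} is not closed in M × M with the product topology. -/
open Cardinal

variable {V : Type*} [AddCommGroup V] [Module ℝ V]

/-- `u : V → ℝ` is mixture preserving on the convex set `M`. -/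
def MixPres (M : Set V) (u : V → ℝ) : Prop :=
  ∀ x ∈ M, ∀ y ∈ M, ∀ α : ℝ, 0 ≤ α → α ≤ 1 →
    u (α • x + (1 - α) • y) = α * u x + (1 - α) * u y

/-- Axiom MR: existence of a mixture-preserving multi-representation of `r` on `M`. -/
def AxMR (M : Set V) (r : V → V → Prop) : Prop :=
  ∃ U : Set (V → ℝ), U.Nonempty ∧ (∀ u ∈ U, MixPres M u) ∧
    ∀ x ∈ M, ∀ y ∈ M, (r x y ↔ ∀ u ∈ U, u x ≥ u y)

/-- Axiom MC (mixture continuity). -/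
def AxMC (M : Set V) (r : V → V → Prop) : Prop :=
  ∀ x ∈ M, ∀ y ∈ M, ∀ z ∈ M,
    (∀ α : ℝ, 0 < α → α ≤ 1 →
      r (α • x + (1 - α) • y) z ∧ ¬ r z (α • x + (1 - α) • y)) →
    r y z

/-- Axiom SI (strong independence). -/
def AxSI (M : Set V) (r : V → V → Prop) : Prop :=
  ∀ x ∈ M, ∀ y ∈ M, ∀ z ∈ M, ∀ α : ℝ, 0 < α → α < 1 →
    (r x y ↔ r (α • x + (1 - α) • z) (α • y + (1 - α) • z))

/-- Axiom CD (countable domination). -/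
def AxCD (M : Set V) (r : V → V → Prop) : Prop :=
  ∃ D : Set (V × V), D.Countable ∧
    (∀ p ∈ D, p.1 ∈ M ∧ p.2 ∈ M ∧ r p.1 p.2) ∧
    ∀ s ∈ M, ∀ t ∈ M, r s t →
      ∃ p ∈ D, ∃ α : ℝ, 0 < α ∧ α < 1 ∧
        r (α • p.1 + (1 - α) • t) (α • p.2 + (1 - α) • s)

/-- Axiom SD (singleton domination). -/
def AxSD (M : Set V) (r : V → V → Prop) : Prop :=
  ∃ x ∈ M, ∃ y ∈ M, r x y ∧
    ∀ s ∈ M, ∀ t ∈ M, r s t →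
      ∃ α : ℝ, 0 < α ∧ α < 1 ∧
        r (α • x + (1 - α) • t) (α • y + (1 - α) • s)

/-- The positive cone of the preorder `r` on `M`. -/
def posCone (M : Set V) (r : V → V → Prop) : Set V :=
  {v | ∃ l : ℝ, 0 < l ∧ ∃ x ∈ M, ∃ y ∈ M, r x y ∧ v = l • (x - y)}

/-- A set is algebraically closed. -/
def AlgClosed (S : Set V) : Prop :=
  ∀ v w : V, (∀ α : ℝ, 0 < α → α ≤ 1 → (1 - α) • v + α • w ∈ S) → v ∈ S

/-- The weak topology on a real vector space: the coarsest topology making all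
linear functionals continuous. -/
def weakTop (W : Type*) [AddCommGroup W] [Module ℝ W] : TopologicalSpace W :=
  ⨅ f : W →ₗ[ℝ] ℝ, TopologicalSpace.induced (⇑f) inferInstance

/-- The linear span of the set of differences of elements of `M`. -/
def diffSpan (M : Set V) : Submodule ℝ V :=
  Submodule.span ℝ {v | ∃ x ∈ M, ∃ y ∈ M, v = x - y}

/-- `u` is strictly increasing for `r` on `M`. -/
def StrIncr (M : Set V) (r : V → V → Prop) (u : V → ℝ) : Prop :=
  (∀ x ∈ M, ∀ y ∈ M, r x y → u x ≥ u y) ∧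
  (∀ x ∈ M, ∀ y ∈ M, r x y → ¬ r y x → u x > u y)

/-- `u : M → ℝ` is mixture preserving (subtype version). -/
def MixPresSub (M : Set V) (u : ↥M → ℝ) : Prop :=
  ∀ (x y : ↥M) (α : ℝ), 0 ≤ α → α ≤ 1 →
    ∀ h : α • (x : V) + (1 - α) • (y : V) ∈ M,
      u ⟨α • (x : V) + (1 - α) • (y : V), h⟩ = α * u x + (1 - α) * u y

/-- The coarsest topology on `M` making every mixture-preserving function `M → ℝ`
continuous. -/
def mixTop (M : Set V) : TopologicalSpace ↥M :=
  ⨅ u : {u : ↥M → ℝ // MixPresSub M u}, TopologicalSpace.induced u.1 inferInstance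

open Filter Topology

/-- Index set of the basis: one distinguished vector, and a positive and a negative copy of
`ℕ ⊕ (ℕ → ℕ)`. -/
abbrev BasisIdx : Type := Option (Bool × (ℕ ⊕ (ℕ → ℕ)))

/-- The unit vector with index `(b, k)`. -/
noncomputable def unitVec (b : Bool) (k : ℕ ⊕ (ℕ → ℕ)) : BasisIdx →₀ ℝ :=
  Finsupp.single (some (b, k)) 1

/-- The generators of the cone, indexed by `ℕ × (ℕ → ℕ)`. -/
noncomputable def coneGen (j : ℕ × (ℕ → ℕ)) : BasisIdx →₀ ℝ :=
  Finsupp.single none ((j.2 j.1 : ℝ) + 1) + (unitVec true (.inl j.1) + unitVec true (.inr j.2))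
    - (unitVec false (.inl j.1) + unitVec false (.inr j.2))

/-- The preorder whose positive cone is generated by the vectors `coneGen j`. -/
def coneRel (x y : BasisIdx →₀ ℝ) : Prop :=
  ∃ l : ℕ × (ℕ → ℕ) →₀ ℝ, 0 ≤ l ∧ x = y + Finsupp.linearCombination ℝ coneGen l

/-- The sign attached to a copy of `ℕ ⊕ (ℕ → ℕ)`. -/
def boolSign (b : Bool) : ℝ := if b then 1 else -1

lemma boolSign_mul_self (b : Bool) : boolSign b * boolSign b = 1 := by
  cases b <;> simp [boolSign]

lemma coneGen_inl (b : Bool) (n : ℕ) (j : ℕ × (ℕ → ℕ)) :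
    coneGen j (some (b, .inl n)) = boolSign b * (if j.1 = n then 1 else 0) := by
  classical
  cases b <;> simp [coneGen, unitVec, boolSign, Finsupp.single_apply] <;> split_ifs <;> simp

open Classical in
lemma coneGen_inr (b : Bool) (f : ℕ → ℕ) (j : ℕ × (ℕ → ℕ)) :
    coneGen j (some (b, .inr f)) = boolSign b * (if j.2 = f then 1 else 0) := by
  cases b <;> simp [coneGen, unitVec, boolSign, Finsupp.single_apply] <;> split_ifs <;> simp

lemma linearCombination_coneGen_apply (l : ℕ × (ℕ → ℕ) →₀ ℝ) (i : BasisIdx) :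
    Finsupp.linearCombination ℝ coneGen l i = ∑ j ∈ l.support, l j * coneGen j i := by
  simp [Finsupp.linearCombination_apply, Finsupp.sum, Finsupp.finsetSum_apply]

/-- A coordinate on which every generator has sign `b` controls the coefficients of the generators
with coordinate `boolSign b`. -/
lemma coeff_le_apply {l : ℕ × (ℕ → ℕ) →₀ ℝ} (hl : 0 ≤ l) (b : Bool) {i : BasisIdx}
    {p : ℕ × (ℕ → ℕ) → Prop} [DecidablePred p]
    (hi : ∀ j, coneGen j i = boolSign b * (if p j then 1 else 0))
    {j : ℕ × (ℕ → ℕ)} (hj : p j) :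
    l j ≤ boolSign b * Finsupp.linearCombination ℝ coneGen l i := by
  have h : boolSign b * Finsupp.linearCombination ℝ coneGen l i
      = ∑ k ∈ l.support, l k * (if p k then 1 else 0) := by
    rw [linearCombination_coneGen_apply, Finset.mul_sum]
    refine Finset.sum_congr rfl fun k _ => ?_
    rw [hi, mul_left_comm, ← mul_assoc (boolSign b), boolSign_mul_self, one_mul]
  have hnn : ∀ k ∈ l.support, 0 ≤ l k * (if p k then 1 else 0) := fun k _ =>
    mul_nonneg (hl k) (by split_ifs <;> norm_num)
  rw [h]
  by_cases hs : j ∈ l.support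
  · simpa [hj] using Finset.single_le_sum hnn hs
  · rw [Finsupp.notMem_support_iff.1 hs]
    exact Finset.sum_nonneg hnn

/-- Elements of the cone whose part of sign `b` is dominated by `z` have uniformly bounded, finitely
supported coefficients. -/
lemma exists_coeff_bound (b : Bool) {z : BasisIdx →₀ ℝ} (hz : 0 ≤ z) :
    ∃ B : ℕ × (ℕ → ℕ) →₀ ℝ, ∀ l : ℕ × (ℕ → ℕ) →₀ ℝ, 0 ≤ l →
      (∀ k, boolSign b * Finsupp.linearCombination ℝ coneGen l (some (b, k)) ≤ z (some (b, k))) →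
      l ≤ B := by
  classical
  refine ⟨Finsupp.onFinset
    (z.support.preimage (fun n : ℕ => some (b, Sum.inl n))
        (Function.Injective.injOn fun _ _ h => by simpa using h) ×ˢ
      z.support.preimage (fun f : ℕ → ℕ => some (b, Sum.inr f))
        (Function.Injective.injOn fun _ _ h => by simpa using h))
    (fun j => min (z (some (b, .inl j.1))) (z (some (b, .inr j.2)))) ?_, ?_⟩
  · intro j hj
    have h1 : 0 ≤ z (some (b, .inl j.1)) := hz _
    have h2 : 0 ≤ z (some (b, .inr j.2)) := hz _
    refine Finset.mem_product.2 ⟨?_, ?_⟩ <;>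
      · rw [Finset.mem_preimage, Finsupp.mem_support_iff]
        intro h
        apply hj
        simp [h, h1, h2]
  · intro l hl h j
    exact le_min
      ((coeff_le_apply hl b (coneGen_inl b j.1) rfl).trans (h _))
      ((coeff_le_apply hl b (coneGen_inr b j.2) rfl).trans (h _))

lemma continuous_mixTop {W : Type*} [AddCommGroup W] [Module ℝ W] {M : Set W} {u : M → ℝ}
    (hu : MixPresSub M u) : Continuous[mixTop M, inferInstance] u :=
  continuous_iff_le_induced.2
    (iInf_le (fun u : {u : M → ℝ // MixPresSub M u} =>
      TopologicalSpace.induced u.1 inferInstance) ⟨u, hu⟩)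

lemma tendsto_mixTop {W ι : Type*} [AddCommGroup W] [Module ℝ W] {M : Set W} {F : Filter ι}
    {s : ι → M} {a : M}
    (h : ∀ u : M → ℝ, MixPresSub M u → Tendsto (fun i => u (s i)) F (𝓝 (u a))) :
    Tendsto s F (@nhds M (mixTop M) a) := by
  rw [mixTop, nhds_iInf, tendsto_iInf]
  rintro ⟨u, hu⟩
  rw [nhds_induced, tendsto_comap_iff]
  exact h u hu

lemma isClosed_bounded_section (M : Set (BasisIdx →₀ ℝ)) (B : ℕ × (ℕ → ℕ) →₀ ℝ)
    (x : BasisIdx →₀ ℝ) (c : ℝ) :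
    @IsClosed M (mixTop M) {y : M | ∃ l : ℕ × (ℕ → ℕ) →₀ ℝ, 0 ≤ l ∧ l ≤ B ∧
      (y : BasisIdx →₀ ℝ) = x + c • Finsupp.linearCombination ℝ coneGen l} := by
  classical
  let _ := mixTop M
  have : CompactSpace (Set.Icc (0 : ℕ × (ℕ → ℕ) → ℝ) B) :=
    isCompact_iff_compactSpace.1 isCompact_Icc
  let S : Set (M × Set.Icc (0 : ℕ × (ℕ → ℕ) → ℝ) B) :=
    {q | ∀ i, (q.1 : BasisIdx →₀ ℝ) i = x i + c * ∑ j ∈ B.support, q.2.1 j * coneGen j i}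
  have hS : IsClosed S := by
    simp only [S, Set.ofPred_forall]
    refine isClosed_iInter fun i => isClosed_eq ?_ ?_
    · have h : Continuous fun y : M => (y : BasisIdx →₀ ℝ) i :=
        continuous_mixTop fun y z α _ _ _ => by simp
      exact h.comp continuous_fst
    · have h : ∀ j, Continuous fun q : M × Set.Icc (0 : ℕ × (ℕ → ℕ) → ℝ) B => q.2.1 j := fun j =>
        (continuous_apply j).comp (continuous_subtype_val.comp continuous_snd)
      exact continuous_const.add (continuous_const.mul
        (continuous_finsetSum _ fun j _ => (h j).mul continuous_const))
  convert isClosedMap_fst_of_compactSpace _ hS using 1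
  ext y
  simp only [Set.mem_ofPred_eq, Set.mem_image, Prod.exists, exists_and_right, exists_eq_right, S]
  constructor
  · rintro ⟨l, hl, hlB, h⟩
    refine ⟨⟨l, Set.mem_Icc.2 ⟨hl, hlB⟩⟩, fun i => ?_⟩
    rw [h, Finsupp.add_apply, Finsupp.smul_apply, linearCombination_coneGen_apply, smul_eq_mul]
    congr 2
    refine Finset.sum_subset (fun j hj => ?_) fun j _ hj => by
      simp [Finsupp.notMem_support_iff.1 hj]
    have h1 : l j ≤ B j := hlB j
    have h0 : 0 ≤ l j := hl j
    rw [Finsupp.mem_support_iff] at hj ⊢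
    intro hB
    exact hj (le_antisymm (hB ▸ h1) h0)
  · rintro ⟨⟨l, hlB⟩, h⟩
    obtain ⟨hl, hlB⟩ := Set.mem_Icc.1 hlB
    have hsupp : ∀ j, l j ≠ 0 → j ∈ B.support := fun j hj => by
      rw [Finsupp.mem_support_iff]
      intro hB
      exact hj (le_antisymm (hB ▸ hlB j) (hl j))
    refine ⟨Finsupp.onFinset B.support l hsupp, hl, hlB, ?_⟩
    ext i
    rw [h, Finsupp.add_apply, Finsupp.smul_apply, linearCombination_coneGen_apply, smul_eq_mul]
    congr 2
    refine (Finset.sum_subset Finsupp.support_onFinset_subset fun j _ hj => ?_).symm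
    exact mul_eq_zero_of_left (Finsupp.notMem_support_iff.1 hj) _

lemma isClosed_coneRel_left {x : BasisIdx →₀ ℝ} (hx : 0 ≤ x) :
    @IsClosed (Set.Ici (0 : BasisIdx →₀ ℝ)) (mixTop _) {y | coneRel y x} := by
  obtain ⟨B, hB⟩ := exists_coeff_bound false hx
  convert isClosed_bounded_section (Set.Ici 0) B x 1 using 1
  ext ⟨y, hy⟩
  simp only [Set.mem_ofPred_eq, coneRel, one_smul]
  constructor
  · rintro ⟨l, hl, h⟩
    refine ⟨l, hl, hB l hl fun k => ?_, h⟩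
    have h0 : 0 ≤ y (some (false, k)) := Set.mem_Ici.1 hy _
    rw [h, Finsupp.add_apply] at h0
    simp only [boolSign, Bool.false_eq_true, if_false]
    linarith
  · rintro ⟨l, hl, -, h⟩
    exact ⟨l, hl, h⟩

lemma isClosed_coneRel_right {x : BasisIdx →₀ ℝ} (hx : 0 ≤ x) :
    @IsClosed (Set.Ici (0 : BasisIdx →₀ ℝ)) (mixTop _) {y | coneRel x y} := by
  obtain ⟨B, hB⟩ := exists_coeff_bound true hx
  convert isClosed_bounded_section (Set.Ici 0) B x (-1) using 1
  ext ⟨y, hy⟩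
  simp only [Set.mem_ofPred_eq, coneRel, neg_smul, one_smul, ← sub_eq_add_neg]
  constructor
  · rintro ⟨l, hl, h⟩
    refine ⟨l, hl, hB l hl fun k => ?_, eq_sub_of_add_eq h.symm⟩
    have h0 : 0 ≤ y (some (true, k)) := Set.mem_Ici.1 hy _
    rw [h, Finsupp.add_apply]
    simp only [boolSign, if_true]
    linarith
  · rintro ⟨l, hl, -, h⟩
    exact ⟨l, hl, (sub_eq_iff_eq_add.1 h.symm)⟩

lemma coneRel_refl (x : BasisIdx →₀ ℝ) : coneRel x x := ⟨0, le_rfl, by simp⟩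

lemma coneRel_trans {x y z : BasisIdx →₀ ℝ} : coneRel x y → coneRel y z → coneRel x z := by
  rintro ⟨l, hl, rfl⟩ ⟨m, hm, rfl⟩
  exact ⟨m + l, add_nonneg hm hl, by rw [map_add, add_assoc]⟩

lemma coneRel_mix_iff {x y : BasisIdx →₀ ℝ} (z : BasisIdx →₀ ℝ) {a : ℝ} (ha : 0 < a) :
    coneRel x y ↔ coneRel (a • x + z) (a • y + z) := by
  constructor
  · rintro ⟨l, hl, rfl⟩
    exact ⟨a • l, smul_nonneg ha.le hl, by rw [map_smul, smul_add, add_right_comm]⟩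
  · rintro ⟨l, hl, h⟩
    refine ⟨a⁻¹ • l, smul_nonneg (inv_nonneg.2 ha.le) hl, ?_⟩
    rw [add_right_comm, add_left_inj] at h
    rw [map_smul, ← inv_smul_smul₀ ha.ne' x, h, smul_add, inv_smul_smul₀ ha.ne']

lemma not_coneRel_single_none_zero : ¬ coneRel (Finsupp.single none 1) 0 := by
  rintro ⟨l, hl, h⟩
  rw [zero_add] at h
  have hl0 : l = 0 := by
    ext j
    refine le_antisymm ?_ (hl j)
    have := coeff_le_apply hl true (coneGen_inl true j.1) (j := j) rfl
    rwa [← h, Finsupp.single_eq_of_ne (by simp), mul_zero] at this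
  rw [hl0, map_zero, Finsupp.single_eq_zero] at h
  exact one_ne_zero h

/-- The filter on `ℕ × (ℕ → ℕ)` along which the function tends to infinity first for pointwise
domination, and then the number tends to infinity. -/
def domFilter : Filter (ℕ × (ℕ → ℕ)) :=
  (atTop : Filter (ℕ → ℕ)).bind fun f => map (fun n => (n, f)) atTop

instance : domFilter.NeBot := by
  rw [neBot_iff, domFilter, Ne, ← empty_mem_iff_bot, mem_bind']
  simp

lemma tendsto_domFilter (A : ℕ → ℝ) (C : (ℕ → ℕ) → ℝ) :
    Tendsto (fun j : ℕ × (ℕ → ℕ) => ((j.2 j.1 : ℝ) + 1)⁻¹ * (A j.1 + C j.2)) domFilter (𝓝 0) := by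
  intro s hs
  rw [domFilter, mem_map, mem_bind']
  filter_upwards [eventually_ge_atTop fun n : ℕ => ⌈(n : ℝ) * (|A n| + 1)⌉₊] with f hf
  have hf' : ∀ n : ℕ, (n : ℝ) * (|A n| + 1) ≤ f n := fun n => Nat.ceil_le.1 (hf n)
  have key : Tendsto (fun n : ℕ => ((f n : ℝ) + 1)⁻¹ * (A n + C f)) atTop (𝓝 0) := by
    refine squeeze_zero_norm' (a := fun n : ℕ => (1 + |C f|) / n) ?_
      (tendsto_const_div_atTop_nhds_zero_nat _)
    filter_upwards [eventually_gt_atTop 0] with n hn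
    have hn' : (0 : ℝ) < n := Nat.cast_pos.2 hn
    have h0 : (0 : ℝ) < (f n : ℝ) + 1 := by positivity
    rw [Real.norm_eq_abs, abs_mul, abs_inv, abs_of_pos h0, inv_mul_eq_div,
      div_le_div_iff₀ h0 hn']
    have h1 := hf' n
    have hA := abs_nonneg (A n)
    have hC := abs_nonneg (C f)
    have h2 : (n : ℝ) ≤ f n := by nlinarith
    have h3 : (n : ℝ) * |A n| ≤ f n := by nlinarith
    nlinarith [abs_add_le (A n) (C f)]
  exact key hs

lemma add_mem_Ici {v w : BasisIdx →₀ ℝ} (hv : v ∈ Set.Ici 0) (hw : w ∈ Set.Ici 0) :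
    v + w ∈ Set.Ici 0 :=
  Set.mem_Ici.2 (add_nonneg (Set.mem_Ici.1 hv) (Set.mem_Ici.1 hw))

lemma add_smul_mem_Ici {v w : BasisIdx →₀ ℝ} (hv : v ∈ Set.Ici 0) {t : ℝ} (ht : 0 ≤ t)
    (hw : w ∈ Set.Ici 0) : v + t • w ∈ Set.Ici 0 :=
  add_mem_Ici hv (Set.mem_Ici.2 (smul_nonneg ht (Set.mem_Ici.1 hw)))

lemma mixPresSub_add_smul {u : Set.Ici (0 : BasisIdx →₀ ℝ) → ℝ} (hu : MixPresSub _ u)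
    (p v w : Set.Ici (0 : BasisIdx →₀ ℝ)) {t : ℝ} (h0 : 0 ≤ t) (h1 : t ≤ 1) :
    u ⟨p + t • (v + w), add_smul_mem_Ici p.2 h0 (add_mem_Ici v.2 w.2)⟩ = u p +
      t * ((u ⟨p + (2 : ℝ) • v, add_smul_mem_Ici p.2 zero_le_two v.2⟩ - u p) / 2 +
        (u ⟨p + (2 : ℝ) • w, add_smul_mem_Ici p.2 zero_le_two w.2⟩ - u p) / 2) := by
  obtain ⟨p, hp⟩ := p
  obtain ⟨v, hv⟩ := v
  obtain ⟨w, hw⟩ := w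
  have hvw : p + (v + w) ∈ Set.Ici (0 : BasisIdx →₀ ℝ) := add_mem_Ici hp (add_mem_Ici hv hw)
  have e1 : (1 / 2 : ℝ) • (p + (2 : ℝ) • v) + (1 - 1 / 2 : ℝ) • (p + (2 : ℝ) • w) = p + (v + w) := by
    module
  have e2 : t • (p + (v + w)) + (1 - t) • p = p + t • (v + w) := by module
  have a1 := hu ⟨p + (2 : ℝ) • v, add_smul_mem_Ici hp zero_le_two hv⟩
    ⟨p + (2 : ℝ) • w, add_smul_mem_Ici hp zero_le_two hw⟩ (1 / 2) (by norm_num)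
    (by norm_num) (by rw [e1]; exact hvw)
  have a2 := hu ⟨p + (v + w), hvw⟩ ⟨p, hp⟩ t h0 h1
    (by rw [e2]; exact add_smul_mem_Ici hp h0 (add_mem_Ici hv hw))
  simp only [e1] at a1
  simp only [e2] at a2
  rw [a2, a1]
  ring

lemma unitVec_mem_Ici (b : Bool) (k : ℕ ⊕ (ℕ → ℕ)) : unitVec b k ∈ Set.Ici 0 :=
  Set.mem_Ici.2 <| Finsupp.single_nonneg.2 zero_le_one

lemma inv_natCast_add_one_nonneg (m : ℕ) : (0 : ℝ) ≤ ((m : ℝ) + 1)⁻¹ := by positivity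

/-- The perturbation of `p` by small multiples of two unit vectors of sign `b`. -/
noncomputable def perturb (b : Bool) (p : Set.Ici (0 : BasisIdx →₀ ℝ)) (j : ℕ × (ℕ → ℕ)) :
    Set.Ici (0 : BasisIdx →₀ ℝ) :=
  ⟨p + ((j.2 j.1 : ℝ) + 1)⁻¹ • (unitVec b (.inl j.1) + unitVec b (.inr j.2)),
    add_smul_mem_Ici p.2 (inv_natCast_add_one_nonneg _)
      (add_mem_Ici (unitVec_mem_Ici _ _) (unitVec_mem_Ici _ _))⟩

lemma tendsto_perturb (b : Bool) (p : Set.Ici (0 : BasisIdx →₀ ℝ)) :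
    Tendsto (perturb b p) domFilter (@nhds _ (mixTop _) p) := by
  refine tendsto_mixTop fun u hu => ?_
  have key := (tendsto_domFilter
    (fun n => (u ⟨p + (2 : ℝ) • unitVec b (.inl n),
      add_smul_mem_Ici p.2 zero_le_two (unitVec_mem_Ici _ _)⟩ - u p) / 2)
    (fun f => (u ⟨p + (2 : ℝ) • unitVec b (.inr f),
      add_smul_mem_Ici p.2 zero_le_two (unitVec_mem_Ici _ _)⟩ - u p) / 2)).const_add (u p)
  rw [add_zero] at key
  refine key.congr fun j => ?_
  exact (mixPresSub_add_smul hu p ⟨_, unitVec_mem_Ici b (.inl j.1)⟩ ⟨_, unitVec_mem_Ici b (.inr j.2)⟩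
    (inv_natCast_add_one_nonneg _) (inv_le_one_of_one_le₀ (by simp))).symm

lemma single_none_mem_Ici : (Finsupp.single none 1 : BasisIdx →₀ ℝ) ∈ Set.Ici 0 :=
  Set.mem_Ici.2 (Finsupp.single_nonneg.2 zero_le_one)

lemma coneRel_perturb (j : ℕ × (ℕ → ℕ)) :
    coneRel (perturb true ⟨_, single_none_mem_Ici⟩ j)
      (perturb false ⟨0, Set.self_mem_Ici⟩ j) := by
  have h : ((j.2 j.1 : ℝ) + 1) ≠ 0 := by positivity
  refine ⟨Finsupp.single j ((j.2 j.1 : ℝ) + 1)⁻¹,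
    Finsupp.single_nonneg.2 (inv_natCast_add_one_nonneg _), ?_⟩
  have e : ((j.2 j.1 : ℝ) + 1)⁻¹ • (Finsupp.single none ((j.2 j.1 : ℝ) + 1) : BasisIdx →₀ ℝ)
      = Finsupp.single none 1 := by
    rw [Finsupp.smul_single, smul_eq_mul, inv_mul_cancel₀ h]
  simp only [perturb, Finsupp.linearCombination_single, coneGen, smul_sub, smul_add, e]
  abel

lemma not_isClosed_coneRel :
    ¬ @IsClosed (Set.Ici (0 : BasisIdx →₀ ℝ) × Set.Ici (0 : BasisIdx →₀ ℝ))
      (@instTopologicalSpaceProd _ _ (mixTop _) (mixTop _)) {p | coneRel p.1 p.2} := by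
  let _ := mixTop (Set.Ici (0 : BasisIdx →₀ ℝ))
  intro h
  exact not_coneRel_single_none_zero (h.mem_of_tendsto
    ((tendsto_perturb true ⟨_, single_none_mem_Ici⟩).prodMk_nhds
      (tendsto_perturb false ⟨0, Set.self_mem_Ici⟩))
    (Eventually.of_forall coneRel_perturb))

theorem stmt_12 :
    ∃ (E : ModuleCat.{0} ℝ) (M : Set E) (r : E → E → Prop),
      M.Nonempty ∧ Convex ℝ M ∧
      (∀ x ∈ M, r x x) ∧
      (∀ x ∈ M, ∀ y ∈ M, ∀ z ∈ M, r x y → r y z → r x z) ∧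
      AxSI M r ∧
      (∀ x : ↥M, @IsClosed ↥M (mixTop M) {y : ↥M | r ↑y ↑x} ∧
        @IsClosed ↥M (mixTop M) {y : ↥M | r ↑x ↑y}) ∧
      ¬ @IsClosed (↥M × ↥M)
          (@instTopologicalSpaceProd ↥M ↥M (mixTop M) (mixTop M))
          {p : ↥M × ↥M | r ↑p.1 ↑p.2} := by
  refine ⟨ModuleCat.of ℝ (BasisIdx →₀ ℝ), Set.Ici (0 : BasisIdx →₀ ℝ), coneRel,
    ⟨0, Set.self_mem_Ici⟩, ?_, fun x _ => coneRel_refl x, fun _ _ _ _ _ _ => coneRel_trans, ?_, ?_, not_isClosed_coneRel⟩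
  · intro x hx y hy a b ha hb _
    exact Set.mem_Ici.2 (add_nonneg (smul_nonneg ha (Set.mem_Ici.1 hx))
      (smul_nonneg hb (Set.mem_Ici.1 hy)))
  · intro x _ y _ z _ a ha _
    exact coneRel_mix_iff _ ha
  · exact fun x => ⟨isClosed_coneRel_left (Set.mem_Ici.1 x.2),
      isClosed_coneRel_right (Set.mem_Ici.1 x.2)⟩
end

section
/- Let V be a real vector space, M ⊆ V a nonempty convex set, and ≽ a preorder on M. Then ≽ admits a multi-representation by strictly increasing mixture-preserving functions (i.e., there is a nonempty set 𝒰 of mixture-preserving functions M → ℝ, each strictly increasing, such that x ≽ y ⟺ u(x) ≥ u(y) for all u ∈ 𝒰) if and only if ≽ satisfies MR and there exists a strictly increasing mixture-preserving function M → ℝ. -/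
open Cardinal

variable {V : Type*} [AddCommGroup V] [Module ℝ V]

theorem MixPres.const_mul_add {M : Set V} {u v : V → ℝ} (hu : MixPres M u) (hv : MixPres M v)
    (c : ℝ) : MixPres M (fun x => c * v x + u x) := by
  intro x hx y hy α h0 h1
  simp only [hu x hx y hy α h0 h1, hv x hx y hy α h0 h1]
  ring

omit [AddCommGroup V] [Module ℝ V] in
theorem StrIncr.const_mul_add {M : Set V} {r : V → V → Prop} {u v : V → ℝ} (hu : StrIncr M r u)
    (hv : ∀ x ∈ M, ∀ y ∈ M, r x y → v x ≥ v y) {c : ℝ} (hc : 0 ≤ c) :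
    StrIncr M r (fun x => c * v x + u x) :=
  ⟨fun x hx y hy hxy =>
    add_le_add (mul_le_mul_of_nonneg_left (hv x hx y hy hxy) hc) (hu.1 x hx y hy hxy),
   fun x hx y hy hxy hyx =>
    add_lt_add_of_le_of_lt (mul_le_mul_of_nonneg_left (hv x hx y hy hxy) hc)
      (hu.2 x hx y hy hxy hyx)⟩

/-- Affine functions of a nonnegative parameter that are ordered have ordered slopes. -/
theorem le_of_forall_nonneg_mul_add_le {a b p q : ℝ}
    (h : ∀ c : ℝ, 0 ≤ c → c * a + p ≤ c * b + q) : a ≤ b := by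
  by_contra! hab
  have hpos : 0 < a - b := sub_pos.2 hab
  have hc := h ((|q - p| + 1) / (a - b)) (by positivity)
  have hmul : (|q - p| + 1) / (a - b) * (a - b) = |q - p| + 1 := div_mul_cancel₀ _ hpos.ne'
  linarith [le_abs_self (q - p), mul_sub ((|q - p| + 1) / (a - b)) a b]

theorem stmt_13 (M : Set V) (hM : M.Nonempty) (hconv : Convex ℝ M)
    (r : V → V → Prop) (hrefl : ∀ x ∈ M, r x x)
    (htrans : ∀ x ∈ M, ∀ y ∈ M, ∀ z ∈ M, r x y → r y z → r x z) :
    (∃ U : Set (V → ℝ), U.Nonempty ∧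
        (∀ u ∈ U, MixPres M u ∧ StrIncr M r u) ∧
        ∀ x ∈ M, ∀ y ∈ M, (r x y ↔ ∀ u ∈ U, u x ≥ u y)) ↔
      (AxMR M r ∧ ∃ u : V → ℝ, MixPres M u ∧ StrIncr M r u) := by
  constructor
  · rintro ⟨U, ⟨u, hu⟩, hU, hrep⟩
    exact ⟨⟨U, ⟨u, hu⟩, fun w hw => (hU w hw).1, hrep⟩, u, hU u hu⟩
  · rintro ⟨⟨U, -, hU, hrep⟩, u, hmix, hincr⟩
    refine ⟨{w | MixPres M w ∧ StrIncr M r w}, ⟨u, hmix, hincr⟩, fun w hw => hw,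
      fun x hx y hy => ⟨fun hxy w hw => hw.2.1 x hx y hy hxy, fun h => ?_⟩⟩
    refine (hrep x hx y hy).2 fun v hv =>
      le_of_forall_nonneg_mul_add_le (p := u y) (q := u x) fun c hc => ?_
    exact h _ ⟨hmix.const_mul_add (hU v hv) c,
      hincr.const_mul_add (fun a ha b hb hab => (hrep a ha b hb).1 hab v hv) hc⟩
end

section
/- Let V be a real vector space and M ⊆ V a nonempty convex set such that the dimension (Module.rank over ℝ) of the linear span of {x − y : x, y ∈ M} is at most ℵ₀. Then every preorder ≽ on M that satisfies SI and MR admits a multi-representation by strictly increasing mixture-preserving functions: there is a nonempty set 𝒰 of mixture-preserving functions M → ℝ, each strictly increasing, such that x ≽ y ⟺ u(x) ≥ u(y) for all u ∈ 𝒰. -/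
open Cardinal

variable {V : Type*} [AddCommGroup V] [Module ℝ V]

/-- The span of the differences of a convex set consists of scaled differences. -/
theorem exists_smul_sub_of_mem_diffSpan {M : Set V} (hM : M.Nonempty) (hconv : Convex ℝ M)
    {v : V} (hv : v ∈ diffSpan M) :
    ∃ l : ℝ, 0 ≤ l ∧ ∃ x ∈ M, ∃ y ∈ M, v = l • (x - y) := by
  induction hv using Submodule.span_induction with
  | mem v hv =>
    obtain ⟨x, hx, y, hy, rfl⟩ := hv
    exact ⟨1, zero_le_one, x, hx, y, hy, (one_smul ℝ _).symm⟩
  | zero =>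
    obtain ⟨x, hx⟩ := hM
    exact ⟨0, le_rfl, x, hx, x, hx, by simp⟩
  | add v w _ _ hv hw =>
    obtain ⟨l, hl, a, ha, b, hb, rfl⟩ := hv
    obtain ⟨m, hm, c, hc, d, hd, rfl⟩ := hw
    rcases (add_nonneg hl hm).eq_or_lt with h | h
    · have hl0 : l = 0 := by linarith
      have hm0 : m = 0 := by linarith
      exact ⟨0, le_rfl, a, ha, b, hb, by simp [hl0, hm0]⟩
    · have hsum : l / (l + m) + m / (l + m) = 1 := by field_simp
      refine ⟨l + m, h.le, _, hconv ha hc (by positivity) (by positivity) hsum,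
        _, hconv hb hd (by positivity) (by positivity) hsum, ?_⟩
      have h1 : (l + m) * (l / (l + m)) = l := by field_simp
      have h2 : (l + m) * (m / (l + m)) = m := by field_simp
      simp only [smul_sub, smul_add, smul_smul, h1, h2]
      abel
  | smul c v _ hv =>
    obtain ⟨l, hl, a, ha, b, hb, rfl⟩ := hv
    rcases le_total 0 c with hc | hc
    · exact ⟨c * l, mul_nonneg hc hl, a, ha, b, hb, smul_smul _ _ _⟩
    · refine ⟨-c * l, mul_nonneg (neg_nonneg.2 hc) hl, b, hb, a, ha, ?_⟩
      rw [smul_smul, ← neg_sub b a, smul_neg, neg_mul, neg_smul]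

/-- Increments of a mixture-preserving function are given by a linear functional. -/
theorem MixPres.exists_linearMap {M : Set V} (hM : M.Nonempty) (hconv : Convex ℝ M)
    {u : V → ℝ} (hu : MixPres M u) :
    ∃ L : V →ₗ[ℝ] ℝ, ∀ x ∈ M, ∀ y ∈ M, u x - u y = L (x - y) := by
  let G : Set (V × ℝ) := (fun x => (x, u x)) '' M
  have hGconv : Convex ℝ G := by
    rintro _ ⟨x, hx, rfl⟩ _ ⟨y, hy, rfl⟩ a b ha hb hab
    refine ⟨a • x + b • y, hconv hx hy ha hb hab, ?_⟩
    obtain rfl : b = 1 - a := by linarith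
    ext
    · simp
    · simpa using hu x hx y hy a ha (by linarith)
  have hgraph : ∀ p ∈ diffSpan G, p.1 = 0 → p.2 = 0 := by
    intro p hp hp0
    obtain ⟨l, -, _, ⟨x, hx, rfl⟩, _, ⟨y, hy, rfl⟩, rfl⟩ :=
      exists_smul_sub_of_mem_diffSpan (hM.image _) hGconv hp
    rcases smul_eq_zero.1 (by simpa using hp0 : l • (x - y) = 0) with h | h
    · simp [h]
    · simp [sub_eq_zero.1 h]
  obtain ⟨L, hL⟩ := (diffSpan G).toLinearPMap.toFun.exists_extend
  refine ⟨L, fun x hx y hy => ?_⟩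
  have hmem : (x - y, u x - u y) ∈ (diffSpan G).toLinearPMap.graph := by
    rw [Submodule.toLinearPMap_graph_eq _ hgraph]
    exact Submodule.subset_span ⟨_, ⟨x, hx, rfl⟩, _, ⟨y, hy, rfl⟩, rfl⟩
  obtain ⟨z, hz1, hz2⟩ := (LinearPMap.mem_graph_iff _).1 hmem
  dsimp only at hz1 hz2
  rw [← hz1, ← hz2]
  exact (LinearMap.congr_fun hL z).symm

/-- A subspace of countable dimension lies in the span of a sequence. -/
theorem Submodule.exists_seq_le_span (W : Submodule ℝ V) (hW : Module.rank ℝ W ≤ aleph0) :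
    ∃ e : ℕ → V, W ≤ span ℝ (Set.range e) := by
  have hc : (Set.range (W.subtype ∘ Module.Basis.ofVectorSpace ℝ W)).Countable := by
    have : Countable (Module.Basis.ofVectorSpaceIndex ℝ W) := by
      rw [← Cardinal.mk_le_aleph0_iff, (Module.Basis.ofVectorSpace ℝ W).mk_eq_rank'']
      exact hW
    exact Set.countable_range _
  obtain ⟨e, he⟩ := (hc.insert 0).exists_eq_range (Set.insert_nonempty _ _)
  refine ⟨e, ?_⟩
  rw [← he, span_insert_zero, Set.range_comp, span_image, (Module.Basis.ofVectorSpace ℝ W).span_eq]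
  simp

/-- A set of functionals has a sequence detecting positivity on a countable-dimensional
subspace. -/
theorem exists_seq_forall_pos {S : Set (V →ₗ[ℝ] ℝ)} (hS : S.Nonempty) (e : ℕ → V) :
    ∃ d : ℕ → V →ₗ[ℝ] ℝ, (∀ n, d n ∈ S) ∧
      ∀ w ∈ Submodule.span ℝ (Set.range e), ∀ L ∈ S, 0 < L w → ∃ n, 0 < d n w := by
  have : Nonempty S := hS.to_subtype
  let T : S → ℕ → ℝ := fun L k => L.1 (e k)
  let _ : TopologicalSpace S := TopologicalSpace.induced T inferInstance
  have : SecondCountableTopology S := TopologicalSpace.secondCountableTopology_induced S _ T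
  refine ⟨fun n => (TopologicalSpace.denseSeq S n).1,
    fun n => (TopologicalSpace.denseSeq S n).2, fun w hw L hL hL0 => ?_⟩
  have hcont : Continuous fun L : S => L.1 w := by
    clear hL0
    induction hw using Submodule.span_induction with
    | mem w hw =>
      obtain ⟨k, rfl⟩ := hw
      exact (continuous_apply k).comp (continuous_induced_dom (f := T))
    | zero => simpa using continuous_const
    | add v w _ _ hv hw =>
      simp only [map_add]
      exact hv.add hw
    | smul c v _ hv =>
      simp only [map_smul, smul_eq_mul]
      exact continuous_const.mul hv
  exact (TopologicalSpace.denseRange_denseSeq S).exists_mem_open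
    (isOpen_lt continuous_const hcont) ⟨⟨L, hL⟩, hL0⟩

/-- A sequence of functionals has positive weights making it pointwise summable on the span of
a sequence. -/
theorem exists_pos_summable (d : ℕ → V →ₗ[ℝ] ℝ) (e : ℕ → V) :
    ∃ c : ℕ → ℝ, (∀ n, 0 < c n) ∧
      ∀ w ∈ Submodule.span ℝ (Set.range e), Summable fun n => c n * d n w := by
  have hpos : ∀ n, 0 < 1 + ∑ k ∈ Finset.range (n + 1), |d n (e k)| := fun n => by positivity
  refine ⟨fun n => (1 / 2) ^ n / (1 + ∑ k ∈ Finset.range (n + 1), |d n (e k)|),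
    fun n => div_pos (by positivity) (hpos n), fun w hw => ?_⟩
  induction hw using Submodule.span_induction with
  | mem w hw =>
    obtain ⟨k, rfl⟩ := hw
    refine Summable.of_norm_bounded_eventually_nat summable_geometric_two ?_
    filter_upwards [Filter.eventually_ge_atTop k] with n hn
    have hle : |d n (e k)| ≤ ∑ k ∈ Finset.range (n + 1), |d n (e k)| :=
      Finset.single_le_sum (f := fun k => |d n (e k)|) (fun _ _ => abs_nonneg _)
        (Finset.mem_range.2 (by omega))
    rw [Real.norm_eq_abs, abs_mul, abs_of_pos (div_pos (by positivity) (hpos n)),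
      div_mul_eq_mul_div, div_le_iff₀ (hpos n)]
    gcongr
    linarith
  | zero => simp
  | add v w _ _ hv hw => simpa [mul_add] using hv.add hw
  | smul a v _ hv => simpa [mul_left_comm] using hv.mul_left a

theorem stmt_14 (M : Set V) (hM : M.Nonempty) (hconv : Convex ℝ M)
    (hdim : Module.rank ℝ ↥(diffSpan M) ≤ aleph0)
    (r : V → V → Prop) (hrefl : ∀ x ∈ M, r x x)
    (htrans : ∀ x ∈ M, ∀ y ∈ M, ∀ z ∈ M, r x y → r y z → r x z)
    (hSI : AxSI M r) (hMR : AxMR M r) :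
    ∃ U : Set (V → ℝ), U.Nonempty ∧
      (∀ u ∈ U, MixPres M u ∧ StrIncr M r u) ∧
      ∀ x ∈ M, ∀ y ∈ M, (r x y ↔ ∀ u ∈ U, u x ≥ u y) := by
  obtain ⟨U, hU, hmix, hrep⟩ := hMR
  obtain ⟨x₀, hx₀⟩ := hM
  choose! D hD using fun u hu => (hmix u hu).exists_linearMap ⟨x₀, hx₀⟩ hconv
  obtain ⟨e, he⟩ := (diffSpan M).exists_seq_le_span hdim
  obtain ⟨d, hdU, hdpos⟩ := exists_seq_forall_pos (hU.image D) e
  obtain ⟨c, hc, hsum⟩ := exists_pos_summable d e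
  have hsub : ∀ x ∈ M, ∀ y ∈ M, x - y ∈ Submodule.span ℝ (Set.range e) :=
    fun x hx y hy => he (Submodule.subset_span ⟨x, hx, y, hy, rfl⟩)
  have hnonneg : ∀ x ∈ M, ∀ y ∈ M, r x y → ∀ n, 0 ≤ c n * d n (x - y) := by
    intro x hx y hy hxy n
    obtain ⟨u, hu, hun⟩ := hdU n
    rw [← hun, ← hD u hu x hx y hy]
    exact mul_nonneg (hc n).le (sub_nonneg.2 ((hrep x hx y hy).1 hxy u hu))
  let F : V → ℝ := fun x => ∑' n, c n * d n (x - x₀)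
  have hFsub : ∀ x ∈ M, ∀ y ∈ M, F x - F y = ∑' n, c n * d n (x - y) := by
    intro x hx y hy
    rw [← (hsum _ (hsub x hx x₀ hx₀)).tsum_sub (hsum _ (hsub y hy x₀ hx₀))]
    refine tsum_congr fun n => ?_
    rw [← mul_sub, ← map_sub, sub_sub_sub_cancel_right]
  have hFmix : MixPres M F := by
    intro x hx y hy α _ _
    simp only [F]
    rw [← tsum_mul_left, ← tsum_mul_left, ← ((hsum _ (hsub x hx x₀ hx₀)).mul_left α).tsum_add
      ((hsum _ (hsub y hy x₀ hx₀)).mul_left (1 - α))]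
    refine tsum_congr fun n => ?_
    simp only [map_sub, map_add, map_smul, smul_eq_mul]
    ring
  have hFle : ∀ x ∈ M, ∀ y ∈ M, r x y → F y ≤ F x := fun x hx y hy hxy => by
    rw [← sub_nonneg, hFsub x hx y hy]
    exact tsum_nonneg (hnonneg x hx y hy hxy)
  have hFlt : ∀ x ∈ M, ∀ y ∈ M, r x y → ¬ r y x → F y < F x := by
    intro x hx y hy hxy hyx
    rw [hrep y hy x hx] at hyx
    push Not at hyx
    obtain ⟨u, hu, hlt⟩ := hyx
    rw [← sub_pos, hD u hu x hx y hy] at hlt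
    obtain ⟨n, hn⟩ := hdpos _ (hsub x hx y hy) _ ⟨u, hu, rfl⟩ hlt
    rw [← sub_pos, hFsub x hx y hy]
    exact (hsum _ (hsub x hx y hy)).tsum_pos (hnonneg x hx y hy hxy) n (mul_pos (hc n) hn)
  refine ⟨{f | ∃ u ∈ U, ∃ ε : ℝ, 0 < ε ∧ f = fun x => u x + ε * F x}, ?_, ?_, ?_⟩
  · obtain ⟨u, hu⟩ := hU
    exact ⟨_, u, hu, 1, one_pos, rfl⟩
  · rintro _ ⟨u, hu, ε, hε, rfl⟩
    refine ⟨fun x hx y hy α h0 h1 => ?_, fun x hx y hy hxy => ?_, fun x hx y hy hxy hyx => ?_⟩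
    · simp only [hmix u hu x hx y hy α h0 h1, hFmix x hx y hy α h0 h1]
      ring
    · exact add_le_add ((hrep x hx y hy).1 hxy u hu)
        (mul_le_mul_of_nonneg_left (hFle x hx y hy hxy) hε.le)
    · exact add_lt_add_of_le_of_lt ((hrep x hx y hy).1 hxy u hu)
        (mul_lt_mul_of_pos_left (hFlt x hx y hy hxy hyx) hε)
  · refine fun x hx y hy => ⟨?_, fun h => (hrep x hx y hy).2 fun u hu => ?_⟩
    · rintro hxy _ ⟨u, hu, ε, hε, rfl⟩
      exact add_le_add ((hrep x hx y hy).1 hxy u hu)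
        (mul_le_mul_of_nonneg_left (hFle x hx y hy hxy) hε.le)
    · have hlim : ∀ z, Filter.Tendsto (fun ε : ℝ => u z + ε * F z)
          (nhdsWithin 0 (Set.Ioi 0)) (nhds (u z)) := fun z => by
        have : Continuous fun ε : ℝ => u z + ε * F z := by fun_prop
        simpa using (this.tendsto 0).mono_left nhdsWithin_le_nhds
      refine le_of_tendsto_of_tendsto (hlim y) (hlim x) ?_
      filter_upwards [self_mem_nhdsWithin] with ε hε
      exact h _ ⟨u, hu, ε, hε, rfl⟩
end

section
/- Let V be a real vector space whose dimension (Module.rank ℝ V) is uncountable. Then there exists a nonempty set 𝒰 of linear functionals V → ℝ such that, for the preorder on V defined by x ≽ y ⟺ f(x) ≥ f(y) for all f ∈ 𝒰 (a preorder which by construction satisfies MR), there is no function g : V → ℝ with g(x) > g(y) whenever x ≻ y; in particular, this preorder satisfies MR but admits no multi-representation by strictly increasing mixture-preserving functions. -/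
open Cardinal

variable {V : Type*} [AddCommGroup V] [Module ℝ V]

/-- A well-order with a strictly monotone map to `ℝ` is countable. -/
theorem StrictMono.countable_of_wellFoundedLT {ι : Type*} [LinearOrder ι] [WellFoundedLT ι]
    {g : ι → ℝ} (hg : StrictMono g) : Countable ι := by
  let _ : SuccOrder ι := SuccOrder.ofLinearWellFoundedLT ι
  have hq : ∀ i : ι, ¬ IsMax i → ∃ q : ℚ, g i < q ∧ (q : ℝ) < g (Order.succ i) := fun i hi =>
    exists_rat_btwn (hg (Order.lt_succ_of_not_isMax hi))
  choose q hq₁ hq₂ using hq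
  have hlt : ∀ i j (hi : ¬ IsMax i) (hj : ¬ IsMax j), i < j → q i hi < q j hj := by
    intro i j hi hj hij
    have h : g (Order.succ i) ≤ g j := hg.monotone (Order.succ_le_of_lt hij)
    exact_mod_cast ((hq₂ i hi).trans_le h).trans (hq₁ j hj)
  have hinj : Function.Injective (fun i : {i : ι // ¬ IsMax i} => q i.1 i.2) :=
    StrictMono.injective fun i j hij => hlt i.1 j.1 i.2 j.2 hij
  have hnonmax : {i : ι | ¬ IsMax i}.Countable := hinj.countable
  have hmax : {i : ι | IsMax i}.Countable :=
    Set.Subsingleton.countable fun i hi j hj =>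
      (le_total i j).elim (fun h => h.antisymm (hi h)) fun h => (hj h).antisymm h
  refine Set.countable_univ_iff.mp ((hmax.union hnonmax).mono fun i _ => ?_)
  exact em (IsMax i)

theorem stmt_15 (h : aleph0 < Module.rank ℝ V) :
    ∃ U : Set (V →ₗ[ℝ] ℝ), U.Nonempty ∧
      ∀ r : V → V → Prop, (∀ x y : V, r x y ↔ ∀ f ∈ U, f x ≥ f y) →
        (¬ ∃ g : V → ℝ, ∀ x y : V, r x y → ¬ r y x → g x > g y) ∧
        ¬ ∃ W : Set (V → ℝ), W.Nonempty ∧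
            (∀ u ∈ W, MixPres (Set.univ : Set V) u ∧ StrIncr Set.univ r u) ∧
            ∀ x y : V, r x y ↔ ∀ u ∈ W, u x ≥ u y := by
  classical
  let b := Module.Basis.ofVectorSpace ℝ V
  set ι := Module.Basis.ofVectorSpaceIndex ℝ V
  have hι : ¬ Countable ι := by
    rwa [← Cardinal.mk_le_aleph0_iff, b.mk_eq_rank'', not_le]
  obtain ⟨_, _⟩ := exists_wellFoundedLT ι
  let F : ι → V →ₗ[ℝ] ℝ := fun β => b.constr ℝ fun α => if β ≤ α then (1 : ℝ) else 0
  have hF : ∀ α β, F β (b α) = if β ≤ α then 1 else 0 := fun α β => b.constr_basis ..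
  have hne : Nonempty ι := not_isEmpty_iff.mp fun _ => hι inferInstance
  refine ⟨Set.range F, Set.range_nonempty F, fun r hr => ?_⟩
  have hrb : ∀ α γ, r (b α) (b γ) ↔ γ ≤ α := by
    intro α γ
    simp only [hr, Set.forall_mem_range, hF]
    refine ⟨fun h => ?_, fun h β => ?_⟩
    · by_contra hlt
      have := h γ
      norm_num [hlt] at this
    · by_cases hβ : β ≤ γ
      · simp [hβ, hβ.trans h]
      · rw [if_neg hβ]
        split_ifs <;> norm_num
  have hno : ¬ ∃ g : V → ℝ, ∀ x y : V, r x y → ¬ r y x → g x > g y := by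
    rintro ⟨g, hg⟩
    have hmono : StrictMono fun i => g (b i) := fun i j hij =>
      hg _ _ ((hrb j i).2 hij.le) fun h => hij.not_ge ((hrb i j).1 h)
    exact hι hmono.countable_of_wellFoundedLT
  refine ⟨hno, ?_⟩
  rintro ⟨W, ⟨u, hu⟩, hW, -⟩
  exact hno ⟨u, fun x y => (hW u hu).2.2 x trivial y trivial⟩
end

section
/- Let V be a real vector space and M ⊆ V a nonempty convex set. Let M* be the set of mixture-preserving functions M → ℝ, viewed inside the real vector space of all functions M → ℝ equipped with the topology of pointwise convergence, and let 𝒞 ⊆ M* be the set of constant functions. For a set 𝒮 of functions M → ℝ, let cone(𝒮) be the set of all finite linear combinations of elements of 𝒮 with nonnegative real coefficients. Then two nonempty sets 𝒰, 𝒰' ⊆ M* represent the same preorder on M (i.e., for all x, y ∈ M: (u(x) ≥ u(y) for all u ∈ 𝒰) ⟺ (u(x) ≥ u(y) for all u ∈ 𝒰')) if and only if the closure of cone(𝒰 ∪ 𝒞) equals the closure of cone(𝒰' ∪ 𝒞) in the topology of pointwise convergence. -/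
open Cardinal

variable {V : Type*} [AddCommGroup V] [Module ℝ V]

/-- The constant functions `M → ℝ`. -/
def constSet (M : Set V) : Set (↥M → ℝ) :=
  {f | ∃ c : ℝ, ∀ x, f x = c}

/-- All finite linear combinations with nonnegative coefficients of elements of `S`. -/
def nnCone {X : Type*} (S : Set (X → ℝ)) : Set (X → ℝ) :=
  {f | ∃ (n : ℕ) (c : Fin n → ℝ) (g : Fin n → (X → ℝ)),
    (∀ i, 0 ≤ c i) ∧ (∀ i, g i ∈ S) ∧ f = ∑ i, c i • g i}

theorem nnCone_eq_span {X : Type*} (S : Set (X → ℝ)) :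
    nnCone S = (Submodule.span {c : ℝ // 0 ≤ c} S : PointedCone ℝ (X → ℝ)) := by
  ext f
  rw [SetLike.mem_coe, Submodule.mem_span_set']
  constructor
  · rintro ⟨n, c, g, hc, hg, rfl⟩
    exact ⟨n, fun i => ⟨c i, hc i⟩, fun i => ⟨g i, hg i⟩, rfl⟩
  · rintro ⟨n, c, g, rfl⟩
    exact ⟨n, fun i => c i, fun i => g i, fun i => (c i).2, fun i => (g i).2, rfl⟩

theorem subset_nnCone {X : Type*} (S : Set (X → ℝ)) : S ⊆ nnCone S := by
  rw [nnCone_eq_span]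
  exact Submodule.subset_span

theorem closure_nnCone_subset_closure_nnCone {X : Type*} {S T : Set (X → ℝ)}
    (h : S ⊆ closure (nnCone T)) : closure (nnCone S) ⊆ closure (nnCone T) := by
  refine closure_minimal ?_ isClosed_closure
  rw [nnCone_eq_span] at h ⊢
  rw [nnCone_eq_span, ← PointedCone.coe_closure] at *
  exact SetLike.coe_subset_coe.2 (Submodule.span_le.2 h)

theorem mixPresSub_of_mem_constSet {M : Set V} {u : ↥M → ℝ} (hu : u ∈ constSet M) :
    MixPresSub M u := by
  obtain ⟨c, hc⟩ := hu
  intro x y α _ _ h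
  rw [hc, hc, hc]
  ring

/-- A nonnegative combination of two evaluations acts on mixture-preserving functions as a
nonnegative multiple of a single evaluation. -/
theorem exists_eval_add {M : Set V} (hconv : Convex ℝ M) (x y : ↥M) {a b : ℝ}
    (ha : 0 ≤ a) (hb : 0 ≤ b) :
    ∃ z : ↥M, ∀ u : ↥M → ℝ, MixPresSub M u → a * u x + b * u y = (a + b) * u z := by
  rcases (add_nonneg ha hb).eq_or_lt with h | h
  · refine ⟨x, fun u _ => ?_⟩
    rw [show a = 0 by linarith, show b = 0 by linarith]
    ring
  · have h0 : 0 ≤ a / (a + b) := by positivity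
    have h1 : a / (a + b) ≤ 1 := (div_le_one h).2 (by linarith)
    have hz : (a / (a + b)) • (x : V) + (1 - a / (a + b)) • (y : V) ∈ M :=
      hconv x.2 y.2 h0 (by linarith) (by ring)
    refine ⟨⟨_, hz⟩, fun u hu => ?_⟩
    rw [hu x y _ h0 h1 hz]
    field_simp
    ring

theorem exists_eval_sub_eval {M : Set V} (hM : M.Nonempty) (hconv : Convex ℝ M)
    (φ : (↥M → ℝ) →L[ℝ] ℝ) :
    ∃ (p q : ℝ) (x y : ↥M), 0 ≤ p ∧ 0 ≤ q ∧
      ∀ u : ↥M → ℝ, MixPresSub M u → φ u = p * u x - q * u y := by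
  have hφ : (φ : (↥M → ℝ) →ₗ[ℝ] ℝ) ∈
      Submodule.span ℝ (Set.range fun x : ↥M => LinearMap.proj (R := ℝ) (φ := fun _ => ℝ) x) :=
    (LinearMap.mem_span_iff_continuous _).2 φ.continuous
  suffices ∀ ψ ∈ Submodule.span ℝ
      (Set.range fun x : ↥M => LinearMap.proj (R := ℝ) (φ := fun _ : ↥M => ℝ) x),
      ∃ (p q : ℝ) (x y : ↥M), 0 ≤ p ∧ 0 ≤ q ∧
        ∀ u : ↥M → ℝ, MixPresSub M u → ψ u = p * u x - q * u y from this _ hφ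
  intro ψ hψ
  obtain ⟨m, hm⟩ := hM
  induction hψ using Submodule.span_induction with
  | mem ψ h =>
    obtain ⟨x, rfl⟩ := h
    exact ⟨1, 0, x, x, zero_le_one, le_rfl, fun u _ => by simp⟩
  | zero => exact ⟨0, 0, ⟨m, hm⟩, ⟨m, hm⟩, le_rfl, le_rfl, fun u _ => by simp⟩
  | add ψ χ _ _ h₁ h₂ =>
    obtain ⟨p₁, q₁, x₁, y₁, hp₁, hq₁, e₁⟩ := h₁
    obtain ⟨p₂, q₂, x₂, y₂, hp₂, hq₂, e₂⟩ := h₂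
    obtain ⟨x, hx⟩ := exists_eval_add hconv x₁ x₂ hp₁ hp₂
    obtain ⟨y, hy⟩ := exists_eval_add hconv y₁ y₂ hq₁ hq₂
    refine ⟨p₁ + p₂, q₁ + q₂, x, y, by positivity, by positivity, fun u hu => ?_⟩
    rw [LinearMap.add_apply, e₁ u hu, e₂ u hu, ← hx u hu, ← hy u hu]
    ring
  | smul c ψ _ h =>
    obtain ⟨p, q, x, y, hp, hq, e⟩ := h
    rcases le_total 0 c with hc | hc
    · refine ⟨c * p, c * q, x, y, by positivity, by positivity, fun u hu => ?_⟩
      rw [LinearMap.smul_apply, e u hu, smul_eq_mul]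
      ring
    · refine ⟨-c * q, -c * p, y, x, mul_nonneg (neg_nonneg.2 hc) hq,
        mul_nonneg (neg_nonneg.2 hc) hp, fun u hu => ?_⟩
      rw [LinearMap.smul_apply, e u hu, smul_eq_mul]
      ring

theorem apply_le_apply_of_mem_closure_nnCone {M : Set V} {U : Set (↥M → ℝ)} {v : ↥M → ℝ}
    (hv : v ∈ closure (nnCone (U ∪ constSet M))) {x y : ↥M} (h : ∀ u ∈ U, u y ≤ u x) :
    v y ≤ v x := by
  refine closure_minimal (t := {f : ↥M → ℝ | f y ≤ f x}) ?_
    (isClosed_le (continuous_apply y) (continuous_apply x)) hv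
  rintro f ⟨n, c, g, hc, hg, rfl⟩
  simp only [Set.mem_ofPred_eq, Finset.sum_apply, Pi.smul_apply, smul_eq_mul]
  refine Finset.sum_le_sum fun i _ => mul_le_mul_of_nonneg_left ?_ (hc i)
  rcases hg i with hi | ⟨a, ha⟩
  · exact h _ hi
  · rw [ha, ha]

theorem mem_closure_nnCone {M : Set V} (hM : M.Nonempty) (hconv : Convex ℝ M)
    {U : Set (↥M → ℝ)} (hU : ∀ u ∈ U, MixPresSub M u) {v : ↥M → ℝ} (hv : MixPresSub M v)
    (h : ∀ x y : ↥M, (∀ u ∈ U, u x ≥ u y) → v x ≥ v y) :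
    v ∈ closure (nnCone (U ∪ constSet M)) := by
  by_contra hmem
  have hsub := (subset_nnCone (U ∪ constSet M)).trans subset_closure
  let K : ProperCone ℝ (↥M → ℝ) :=
    ⟨PointedCone.closure (Submodule.span {c : ℝ // 0 ≤ c} (U ∪ constSet M)), isClosed_closure⟩
  have hK : (K : Set (↥M → ℝ)) = closure (nnCone (U ∪ constSet M)) := by
    rw [nnCone_eq_span]
    rfl
  rw [← hK] at hmem hsub
  obtain ⟨φ, hφ, hφv⟩ := K.hyperplane_separation_point hmem
  obtain ⟨p, q, x, y, hp, hq, e⟩ := exists_eval_sub_eval hM hconv φ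
  have hconst (a : ℝ) : 0 ≤ p * a - q * a := by
    have ha : (fun _ => a) ∈ constSet M := ⟨a, fun _ => rfl⟩
    rw [← e _ (mixPresSub_of_mem_constSet ha)]
    exact hφ _ (hsub (Or.inr ha))
  obtain rfl : p = q := by linarith [hconst 1, hconst (-1)]
  rw [e v hv] at hφv
  have hp' : 0 < p := hp.lt_of_ne (by rintro rfl; simp at hφv)
  have hxy : v x ≥ v y := h x y fun u hu => by
    have := hφ u (hsub (Or.inl hu))
    rw [e u (hU u hu), ← mul_sub] at this
    exact sub_nonneg.1 (nonneg_of_mul_nonneg_right this hp')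
  linarith [mul_le_mul_of_nonneg_left hxy hp]

theorem closure_nnCone_subset_of_forall {M : Set V} (hM : M.Nonempty) (hconv : Convex ℝ M)
    {U U' : Set (↥M → ℝ)} (hU : ∀ u ∈ U, MixPresSub M u) (hU' : ∀ u ∈ U', MixPresSub M u)
    (h : ∀ x y : ↥M, (∀ u ∈ U', u x ≥ u y) → ∀ u ∈ U, u x ≥ u y) :
    closure (nnCone (U ∪ constSet M)) ⊆ closure (nnCone (U' ∪ constSet M)) := by
  refine closure_nnCone_subset_closure_nnCone (Set.union_subset (fun u hu => ?_) fun u hu => ?_)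
  · exact mem_closure_nnCone hM hconv hU' (hU u hu) fun x y hxy => h x y hxy u hu
  · exact subset_closure (subset_nnCone _ (Or.inr hu))

theorem stmt_16 (M : Set V) (hM : M.Nonempty) (hconv : Convex ℝ M)
    (U U' : Set (↥M → ℝ)) (hU : U.Nonempty) (hU' : U'.Nonempty)
    (hUm : ∀ u ∈ U, MixPresSub M u) (hU'm : ∀ u ∈ U', MixPresSub M u) :
    (∀ x y : ↥M, (∀ u ∈ U, u x ≥ u y) ↔ (∀ u ∈ U', u x ≥ u y)) ↔
      closure (nnCone (U ∪ constSet M)) = closure (nnCone (U' ∪ constSet M)) := by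
  constructor
  · intro h
    exact (closure_nnCone_subset_of_forall hM hconv hUm hU'm fun x y => (h x y).2).antisymm
      (closure_nnCone_subset_of_forall hM hconv hU'm hUm fun x y => (h x y).1)
  · intro h x y
    have hsub (S : Set (↥M → ℝ)) : S ⊆ closure (nnCone (S ∪ constSet M)) := fun u hu =>
      subset_closure (subset_nnCone _ (Or.inl hu))
    exact ⟨fun hxy u hu => apply_le_apply_of_mem_closure_nnCone (h ▸ hsub U' hu) hxy,
      fun hxy u hu => apply_le_apply_of_mem_closure_nnCone (h ▸ hsub U hu) hxy⟩
end

section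
/- Let V be a real vector space, M ⊆ V a nonempty convex set, and ≽ a preorder on M satisfying SI. Then weak dominance is a preorder on the graph Γ = {(x,y) ∈ M × M : x ≽ y}: every (x,y) ∈ Γ weakly dominates itself, and for (x,y), (s,t), (p,q) ∈ Γ, if (x,y) weakly dominates (s,t) and (s,t) weakly dominates (p,q), then (x,y) weakly dominates (p,q). -/
open Cardinal

variable {V : Type*} [AddCommGroup V] [Module ℝ V]

/-- Under strong independence, mixing two comparisons with the same weights gives a comparison. -/
theorem AxSI.mix {M : Set V} {r : V → V → Prop} (hSI : AxSI M r) (hconv : Convex ℝ M)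
    (htrans : ∀ x ∈ M, ∀ y ∈ M, ∀ z ∈ M, r x y → r y z → r x z)
    {a b c d : V} (ha : a ∈ M) (hb : b ∈ M) (hc : c ∈ M) (hd : d ∈ M)
    (hab : r a b) (hcd : r c d) {l : ℝ} (hl0 : 0 < l) (hl1 : l < 1) :
    r (l • a + (1 - l) • c) (l • b + (1 - l) • d) := by
  have hmem : ∀ {u v : V}, u ∈ M → v ∈ M → l • u + (1 - l) • v ∈ M := fun hu hv =>
    hconv hu hv hl0.le (sub_pos.2 hl1).le (add_sub_cancel l 1)
  have h₁ := (hSI a ha b hb c hc l hl0 hl1).1 hab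
  have h₂ := (hSI c hc d hd b hb (1 - l) (by linarith) (by linarith)).1 hcd
  rw [sub_sub_cancel, add_comm, add_comm ((1 - l) • d)] at h₂
  exact htrans _ (hmem ha hc) _ (hmem hb hc) _ (hmem hb hd) h₁ h₂

theorem stmt_17 (M : Set V) (hM : M.Nonempty) (hconv : Convex ℝ M)
    (r : V → V → Prop) (hrefl : ∀ x ∈ M, r x x)
    (htrans : ∀ x ∈ M, ∀ y ∈ M, ∀ z ∈ M, r x y → r y z → r x z)
    (hSI : AxSI M r) :
    (∀ x ∈ M, ∀ y ∈ M, r x y →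
        ∃ α : ℝ, 0 < α ∧ α < 1 ∧ r (α • x + (1 - α) • y) (α • y + (1 - α) • x)) ∧
    (∀ x ∈ M, ∀ y ∈ M, ∀ s ∈ M, ∀ t ∈ M, ∀ p ∈ M, ∀ q ∈ M,
        r x y → r s t → r p q →
        (∃ α : ℝ, 0 < α ∧ α < 1 ∧ r (α • x + (1 - α) • t) (α • y + (1 - α) • s)) →
        (∃ α : ℝ, 0 < α ∧ α < 1 ∧ r (α • s + (1 - α) • q) (α • t + (1 - α) • p)) →
        (∃ α : ℝ, 0 < α ∧ α < 1 ∧ r (α • x + (1 - α) • q) (α • y + (1 - α) • p))) := by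
  have hmem : ∀ {u v : V} {l : ℝ}, u ∈ M → v ∈ M → 0 < l → l < 1 → l • u + (1 - l) • v ∈ M :=
    fun hu hv h0 h1 => hconv hu hv h0.le (sub_pos.2 h1).le (add_sub_cancel _ 1)
  refine ⟨fun x hx y hy _ => ⟨1 / 2, by norm_num, by norm_num, ?_⟩, ?_⟩
  · have heq : (1 / 2 : ℝ) • y + (1 - 1 / 2 : ℝ) • x = (1 / 2 : ℝ) • x + (1 - 1 / 2 : ℝ) • y := by
      module
    rw [heq]
    exact hrefl _ (hmem hx hy (by norm_num) (by norm_num))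
  · rintro x hx y hy s hs t ht p hp q hq - - - ⟨α, hα0, hα1, h₁⟩ ⟨β, hβ0, hβ1, h₂⟩
    have hα : 0 < 1 - α := sub_pos.2 hα1
    have hβ : 0 < 1 - β := sub_pos.2 hβ1
    have hS : 0 < β + (1 - α) := by positivity
    have hT : 0 < α * β + (1 - α) * (1 - β) := by positivity
    have hγ0 : 0 < α * β / (α * β + (1 - α) * (1 - β)) := by positivity
    have hγ1 : α * β / (α * β + (1 - α) * (1 - β)) < 1 := by
      rw [div_lt_one hT]
      linarith [mul_pos hα hβ]
    refine ⟨_, hγ0, hγ1, ?_⟩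
    have hmix := hSI.mix hconv htrans (hmem hx ht hα0 hα1) (hmem hy hs hα0 hα1)
      (hmem hs hq hβ0 hβ1) (hmem ht hp hβ0 hβ1) h₁ h₂ (l := β / (β + (1 - α)))
      (by positivity) (by rw [div_lt_one hS]; linarith)
    refine (hSI _ (hmem hx hq hγ0 hγ1) _ (hmem hy hp hγ0 hγ1)
      ((1 / 2 : ℝ) • s + (1 - 1 / 2 : ℝ) • t) (hmem hs ht (by norm_num) (by norm_num))
      ((α * β + (1 - α) * (1 - β)) / (β + (1 - α))) (by positivity) ?_).2 ?_
    · rw [div_lt_one hS]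
      linarith [mul_pos hα hβ0]
    · convert hmix using 1 <;> match_scalars <;> field_simp <;> ring
end

section
/- Let V be a real vector space, M ⊆ V a nonempty convex set, and ≽ a preorder on M. If 𝒰 is a nonempty set of mixture-preserving functions M → ℝ such that for all x, y ∈ M, x ≽ y ⟺ u(x) ≥ u(y) for all u ∈ 𝒰, then there exists 𝒰' ⊆ 𝒰 which is also a nonempty multi-representation of ≽ and whose cardinality satisfies #𝒰' ≤ max(ℵ₀, Module.rank ℝ (span of {x − y : x, y ∈ M})). -/
open Cardinal

variable {V : Type*} [AddCommGroup V] [Module ℝ V]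

/-- A mixture-preserving function commutes with centers of mass of points of a convex set. -/
theorem MixPres.map_centerMass {M : Set V} (hconv : Convex ℝ M) {u : V → ℝ} (hu : MixPres M u)
    {ι : Type*} (s : Finset ι) (w : ι → ℝ) (p : ι → V) (hw : ∀ i ∈ s, 0 ≤ w i)
    (hpos : 0 < ∑ i ∈ s, w i) (hp : ∀ i ∈ s, p i ∈ M) :
    u (s.centerMass w p) = s.centerMass w (u ∘ p) := by
  have hmix : ∀ x ∈ M, ∀ y ∈ M, ∀ a b : ℝ, 0 ≤ a → 0 ≤ b → a + b = 1 →
      u (a • x + b • y) = a • u x + b • u y := by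
    intro x hx y hy a b ha hb hab
    obtain rfl : b = 1 - a := by linarith
    exact hu x hx y hy a ha (by linarith)
  have hcvx : ConvexOn ℝ M u :=
    ⟨hconv, fun x hx y hy a b ha hb hab => (hmix x hx y hy a b ha hb hab).le⟩
  have hccv : ConcaveOn ℝ M u :=
    ⟨hconv, fun x hx y hy a b ha hb hab => (hmix x hx y hy a b ha hb hab).ge⟩
  exact le_antisymm (hcvx.map_centerMass_le hw hpos hp) (hccv.le_map_centerMass hw hpos hp)

/-- A mixture-preserving function respects affine dependences among points of a convex set. -/
theorem MixPres.sum_eq_zero {M : Set V} (hconv : Convex ℝ M) {u : V → ℝ} (hu : MixPres M u)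
    {ι : Type*} (s : Finset ι) (a : ι → ℝ) (p : ι → V) (hp : ∀ i ∈ s, p i ∈ M)
    (ha : ∑ i ∈ s, a i = 0) (hap : ∑ i ∈ s, a i • p i = 0) :
    ∑ i ∈ s, a i * u (p i) = 0 := by
  have hsplit : ∀ i, a i = (a i)⁺ - (a i)⁻ := fun i => (posPart_sub_negPart (a i)).symm
  have hsum : ∑ i ∈ s, (a i)⁺ = ∑ i ∈ s, (a i)⁻ := by
    rw [← sub_eq_zero, ← Finset.sum_sub_distrib, ← ha]
    exact Finset.sum_congr rfl fun i _ => (hsplit i).symm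
  have hvec : ∑ i ∈ s, (a i)⁺ • p i = ∑ i ∈ s, (a i)⁻ • p i := by
    rw [← sub_eq_zero, ← Finset.sum_sub_distrib, ← hap]
    exact Finset.sum_congr rfl fun i _ => by rw [← sub_smul, ← hsplit i]
  have hnn : ∀ i ∈ s, 0 ≤ (a i)⁺ := fun i _ => posPart_nonneg _
  have hnn' : ∀ i ∈ s, 0 ≤ (a i)⁻ := fun i _ => negPart_nonneg _
  rcases (Finset.sum_nonneg hnn).eq_or_lt with h0 | hpos
  · refine Finset.sum_eq_zero fun i hi => ?_
    have h₁ := (Finset.sum_eq_zero_iff_of_nonneg hnn).1 h0.symm i hi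
    have h₂ := (Finset.sum_eq_zero_iff_of_nonneg hnn').1 (hsum ▸ h0.symm) i hi
    rw [hsplit i, h₁, h₂]
    simp
  · have h₁ := hu.map_centerMass hconv s _ p hnn hpos hp
    have h₂ := hu.map_centerMass hconv s _ p hnn' (hsum ▸ hpos) hp
    simp only [Finset.centerMass, Function.comp_apply, smul_eq_mul] at h₁ h₂
    rw [hvec, hsum, h₂] at h₁
    have h₃ := mul_left_cancel₀ (inv_ne_zero (hsum ▸ hpos.ne')) h₁
    rw [← sub_eq_zero.2 h₃.symm, ← Finset.sum_sub_distrib]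
    exact Finset.sum_congr rfl fun i _ => by rw [← sub_mul, ← hsplit i]

/-- The increments of a mixture-preserving function on a convex set are given by a linear
functional on the ambient space. -/
theorem MixPres.exists_linear {M : Set V} (hconv : Convex ℝ M) {u : V → ℝ} (hu : MixPres M u) :
    ∃ f : V →ₗ[ℝ] ℝ, ∀ x ∈ M, ∀ y ∈ M, u x - u y = f (x - y) := by
  let L : (M →₀ ℝ) →ₗ[ℝ] V × ℝ := Finsupp.linearCombination ℝ fun x : M => ((x : V), (1 : ℝ))
  let T : (M →₀ ℝ) →ₗ[ℝ] ℝ := Finsupp.linearCombination ℝ fun x : M => u x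
  have hT : T ∈ LinearMap.range L.dualMap := by
    rw [LinearMap.range_dualMap_eq_dualAnnihilator_ker, Submodule.mem_dualAnnihilator]
    intro a ha
    rw [LinearMap.mem_ker] at ha
    simp only [L, Finsupp.linearCombination_apply, Finsupp.sum, Prod.smul_mk, Prod.ext_iff,
      Prod.fst_sum, Prod.snd_sum, Prod.fst_zero, Prod.snd_zero, smul_eq_mul, mul_one] at ha
    exact hu.sum_eq_zero hconv a.support a (fun x : M => (x : V)) (fun x _ => x.2) ha.2 ha.1
  obtain ⟨g, hg⟩ := hT
  have key : ∀ x ∈ M, u x = g (x, 1) := by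
    intro x hx
    have := LinearMap.congr_fun hg (Finsupp.single ⟨x, hx⟩ 1)
    simpa [L, T] using this.symm
  refine ⟨g ∘ₗ LinearMap.inl ℝ V ℝ, fun x hx y hy => ?_⟩
  rw [key x hx, key y hy, ← map_sub]
  simp

/-- A family of linear functionals on `W` has a subfamily of cardinality at most
`max ℵ₀ (dim W)` that is negative at some member wherever the whole family is. -/
theorem exists_subfamily_neg.{u} {W κ : Type u} [AddCommGroup W] [Module ℝ W]
    (f : κ → W →ₗ[ℝ] ℝ) :
    ∃ T : Set κ, Cardinal.mk T ≤ max ℵ₀ (Module.rank ℝ W) ∧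
      ∀ w, ∀ k, f k w < 0 → ∃ j ∈ T, f j w < 0 := by
  let ι := Module.Basis.ofVectorSpaceIndex ℝ W
  let b : Module.Basis ι ℝ W := Module.Basis.ofVectorSpace ℝ W
  let O : (S : Finset ι) → κ → Set (S → ℝ) := fun S k => {c | ∑ i, c i * f k (b i) < 0}
  have hO : ∀ S k, IsOpen (O S k) := fun S k => isOpen_lt (by fun_prop) continuous_const
  choose T hTc hT using fun S => TopologicalSpace.isOpen_iUnion_countable (O S) (hO S)
  have hℵ : ℵ₀ ≤ max ℵ₀ (Module.rank ℝ W) := le_max_left _ _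
  refine ⟨⋃ S, T S, ?_, fun w k hk => ?_⟩
  · have hfin : Cardinal.mk (Finset ι) ≤ max ℵ₀ (Module.rank ℝ W) := by
      rw [← b.mk_eq_rank'']
      cases finite_or_infinite ι
      · exact (Cardinal.mk_le_aleph0).trans (le_max_left _ _)
      · exact (Cardinal.mk_finset_of_infinite ι).le.trans (le_max_right _ _)
    refine (Cardinal.mk_iUnion_le _).trans (Cardinal.mul_le_of_le hℵ hfin ?_)
    exact ciSup_le' fun S => (hTc S).le_aleph0.trans hℵ
  · have hcoord : ∀ j, f j w =
        ∑ i : (b.repr w).support, b.repr w i * f j (b i) := by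
      intro j
      conv_lhs => rw [← b.linearCombination_repr w, Finsupp.linearCombination_apply, Finsupp.sum,
        map_sum]
      rw [Finset.sum_coe_sort (b.repr w).support fun i => b.repr w i * f j (b i)]
      simp
    have hmem : (fun i : (b.repr w).support => b.repr w i) ∈ ⋃ j, O (b.repr w).support j :=
      Set.mem_iUnion.2 ⟨k, (hcoord k).symm.trans_lt hk⟩
    rw [← hT] at hmem
    obtain ⟨j, hj, hneg⟩ := Set.mem_iUnion₂.1 hmem
    exact ⟨j, Set.mem_iUnion.2 ⟨_, hj⟩, (hcoord j).trans_lt hneg⟩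

theorem stmt_19 (M : Set V) (hM : M.Nonempty) (hconv : Convex ℝ M)
    (r : V → V → Prop) (hrefl : ∀ x ∈ M, r x x)
    (htrans : ∀ x ∈ M, ∀ y ∈ M, ∀ z ∈ M, r x y → r y z → r x z)
    (U : Set (V → ℝ)) (hUne : U.Nonempty) (hUm : ∀ u ∈ U, MixPres M u)
    (hrep : ∀ x ∈ M, ∀ y ∈ M, (r x y ↔ ∀ u ∈ U, u x ≥ u y)) :
    ∃ U' ⊆ U, U'.Nonempty ∧
      (∀ x ∈ M, ∀ y ∈ M, (r x y ↔ ∀ u ∈ U', u x ≥ u y)) ∧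
      Cardinal.mk ↥U' ≤ max aleph0 (Module.rank ℝ ↥(diffSpan M)) := by
  choose f hf using fun u : U => (hUm u u.2).exists_linear hconv
  obtain ⟨T, hTcard, hT⟩ := exists_subfamily_neg fun u : U => f u ∘ₗ (diffSpan M).subtype
  obtain ⟨u₀, hu₀⟩ := hUne
  have hsub : insert u₀ (Set.image Subtype.val T) ⊆ U :=
    Set.insert_subset hu₀ (Subtype.coe_image_subset U T)
  refine ⟨insert u₀ (Set.image Subtype.val T), hsub, Set.insert_nonempty _ _, ?_, ?_⟩
  · intro x hx y hy
    rw [hrep x hx y hy]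
    refine ⟨fun h u hu => h u (hsub hu), fun h u hu => ?_⟩
    by_contra hlt
    have hmem : x - y ∈ diffSpan M := Submodule.subset_span ⟨x, hx, y, hy, rfl⟩
    have hneg : f ⟨u, hu⟩ (x - y) < 0 := by
      rw [← hf ⟨u, hu⟩ x hx y hy]
      exact sub_neg.2 (not_le.1 hlt)
    obtain ⟨v, hvT, hv⟩ := hT ⟨x - y, hmem⟩ ⟨u, hu⟩ hneg
    change f v (x - y) < 0 at hv
    rw [← hf v x hx y hy] at hv
    linarith [h v (Set.mem_insert_of_mem _ ⟨v, hvT, rfl⟩)]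
  · have hℵ : ℵ₀ ≤ max ℵ₀ (Module.rank ℝ (diffSpan M)) := le_max_left _ _
    refine (Cardinal.mk_insert_le).trans (Cardinal.add_le_of_le hℵ ?_ ?_)
    · exact Cardinal.mk_image_le.trans hTcard
    · exact Cardinal.one_le_aleph0.trans hℵ
end
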